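/- arXiv:2505.02058 — 2 statements merged into one kernel-verified Lean document; each statement's English description precedes it below -/
import Mathlib

section
/- For every integer n ≥ 3 and all integers i, j with 1 ≤ i < j ≤ n, the proportion of derangements of {1,…,n} in which i precedes j satisfies (1/d_n)·#{σ ∈ D_n : σ⁻¹(i) < σ⁻¹(j)} = 1/2 + ((1 − 2(j−i))·n + 2(j−i))/(2n(n−1)(n−2)) + [((−1)^n/n!)/(∑_{l=0}^n (−1)^l/l!)]·(2(j−i) − n)/(2n(n−2)). -/
/-- Number of inversions of a permutation of `Fin n`: the number of pairs of
positions `a < b` with `σ a > σ b`. -/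
def inversions {n : ℕ} (σ : Equiv.Perm (Fin n)) : ℕ :=
  ((Finset.univ : Finset (Fin n × Fin n)).filter
    (fun p => p.1 < p.2 ∧ σ p.2 < σ p.1)).card

/-- The set of derangements (fixed-point-free permutations) of `Fin n`. -/
def derangeSet (n : ℕ) : Finset (Equiv.Perm (Fin n)) :=
  Finset.univ.filter (fun σ => ∀ x, σ x ≠ x)

/-- The number of derangements of `Fin n` (so `numDerange 0 = 1`). -/
def numDerange (n : ℕ) : ℕ := (derangeSet n).card

/-- The number of fixed points of a permutation of `Fin n`. -/
def fixedPointCount {n : ℕ} (σ : Equiv.Perm (Fin n)) : ℕ :=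
  (Finset.univ.filter (fun x => σ x = x)).card

/-- The set of permutations of `Fin n` with exactly `k` fixed points. -/
def permsWithFixed (n k : ℕ) : Finset (Equiv.Perm (Fin n)) :=
  Finset.univ.filter (fun σ => fixedPointCount σ = k)

/-- The number of permutations of `Fin n` with exactly `k` fixed points. -/
def numPermsWithFixed (n k : ℕ) : ℕ := (permsWithFixed n k).card

open Equiv Finset

theorem mem_derangeSet {n : ℕ} {σ : Perm (Fin n)} : σ ∈ derangeSet n ↔ ∀ x, σ x ≠ x := by
  simp [derangeSet]

theorem numDerange_eq_numDerangements (n : ℕ) : numDerange n = numDerangements n := by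
  rw [← card_derangements_fin_eq_numDerangements, numDerange, derangeSet]
  rw [← Fintype.card_subtype]
  exact Fintype.card_congr (Equiv.refl _)

theorem conj_mem_derangeSet {n : ℕ} {σ : Perm (Fin n)} (τ : Perm (Fin n)) (h : σ ∈ derangeSet n) :
    τ * σ * τ⁻¹ ∈ derangeSet n := by
  rw [mem_derangeSet] at h ⊢
  intro x hx
  apply h (τ⁻¹ x)
  rw [Perm.eq_inv_iff_eq]
  simpa using hx

/-- Conjugation invariance of counts of derangements. -/
theorem card_filter_derangeSet_conj {n : ℕ} (τ : Perm (Fin n)) (p q : Perm (Fin n) → Prop)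
    [DecidablePred p] [DecidablePred q] (h : ∀ σ ∈ derangeSet n, p σ ↔ q (τ * σ * τ⁻¹)) :
    ((derangeSet n).filter p).card = ((derangeSet n).filter q).card := by
  refine Finset.card_bij' (fun σ _ => τ * σ * τ⁻¹) (fun σ _ => τ⁻¹ * σ * τ) ?_ ?_ ?_ ?_
  · intro σ hσ
    rw [mem_filter] at hσ ⊢
    exact ⟨conj_mem_derangeSet τ hσ.1, (h σ hσ.1).1 hσ.2⟩
  · intro σ hσ
    rw [mem_filter] at hσ ⊢
    have hm : τ⁻¹ * σ * τ ∈ derangeSet n := by simpa using conj_mem_derangeSet τ⁻¹ hσ.1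
    refine ⟨hm, (h _ hm).2 ?_⟩
    have e : τ * (τ⁻¹ * σ * τ) * τ⁻¹ = σ := by group
    rw [e]
    exact hσ.2
  · intro σ _
    group
  · intro σ _
    group

/-- Derangements containing a prescribed transposition. -/
theorem card_filter_swap {n : ℕ} {x y : Fin n} (hxy : x ≠ y) :
    ((derangeSet n).filter (fun σ => σ x = y ∧ σ y = x)).card = numDerangements (n - 2) := by
  have hc : Fintype.card {a : Fin n // a ≠ x ∧ a ≠ y} = n - 2 := by
    have e : (univ.filter (fun a : Fin n => a ≠ x ∧ a ≠ y)) = ({x, y} : Finset (Fin n))ᶜ := by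
      ext a
      simp
    rw [Fintype.card_subtype, e, card_compl, card_pair hxy, Fintype.card_fin]
  rw [← hc, ← card_derangements_eq_numDerangements,
    Fintype.card_congr (derangements.subtypeEquiv _), Fintype.card_subtype]
  have key : ∀ σ : Perm (Fin n), (σ ∈ derangeSet n ∧ σ x = y ∧ σ y = x) ↔
      ∀ a, ¬(a ≠ x ∧ a ≠ y) ↔ a ∈ Function.fixedPoints (swap x y * σ) := by
    intro σ
    simp only [mem_derangeSet, Function.mem_fixedPoints, Function.IsFixedPt, Perm.mul_apply]
    constructor
    · rintro ⟨hd, h1, h2⟩ a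
      by_cases hax : a = x
      · subst hax
        simp [h1]
      by_cases hay : a = y
      · subst hay
        simp [h2]
      have h3 : σ a ≠ x := fun h => hay (σ.injective (h.trans h2.symm))
      have h4 : σ a ≠ y := fun h => hax (σ.injective (h.trans h1.symm))
      simp [hax, hay, swap_apply_of_ne_of_ne h3 h4, hd a]
    · intro h
      have h1 : σ x = y := by
        have := (h x).1 (by simp)
        simpa [swap_apply_eq_iff] using this
      have h2 : σ y = x := by
        have := (h y).1 (by simp)
        simpa [swap_apply_eq_iff] using this
      refine ⟨fun a ha => ?_, h1, h2⟩
      by_cases hax : a = x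
      · subst hax
        exact hxy (ha.symm.trans h1)
      by_cases hay : a = y
      · subst hay
        exact hxy (h2.symm.trans ha)
      have := (h a).2 (by rw [ha, swap_apply_of_ne_of_ne hax hay])
      exact this ⟨hax, hay⟩
  refine Finset.card_bij' (fun σ _ => swap x y * σ) (fun σ _ => swap x y * σ) ?_ ?_ ?_ ?_
  · intro σ hσ
    rw [mem_filter] at hσ ⊢
    exact ⟨mem_univ _, (key σ).1 hσ⟩
  · intro σ hσ
    rw [mem_filter] at hσ ⊢
    apply (key _).2
    simpa using hσ.2
  · intro σ _
    simp
  · intro σ _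
    simp

/-- The image of a given point is equidistributed over the other points. -/
theorem card_filter_apply_eq {n : ℕ} {x y : Fin n} (hxy : x ≠ y) :
    (n - 1) * ((derangeSet n).filter (fun σ => σ x = y)).card = numDerangements n := by
  rw [← numDerange_eq_numDerangements, numDerange,
    card_eq_sum_card_fiberwise (s := derangeSet n) (f := fun σ : Perm (Fin n) => σ x) (t := ({x} : Finset (Fin n))ᶜ)
      (fun σ hσ => by simpa using mem_derangeSet.1 hσ x)]
  rw [sum_const_nat (m := ((derangeSet n).filter (fun σ => σ x = y)).card)]
  · rw [card_compl, card_singleton, Fintype.card_fin]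
  · intro z hz
    have hzx : x ≠ z := by simpa [eq_comm] using hz
    refine card_filter_derangeSet_conj (swap z y) _ _ fun σ _ => ?_
    simp [swap_apply_of_ne_of_ne hzx hxy, swap_apply_eq_iff]

/-- Among derangements sending `x` to `y`, the preimage of `x` is equidistributed over the points
other than `x` and `y`. -/
theorem card_filter_apply_eq_inv_mem {n : ℕ} {x y : Fin n} (hxy : x ≠ y) (T : Finset (Fin n))
    (hx : x ∉ T) (hy : y ∉ T) :
    (n - 1) * (n - 2) * ((derangeSet n).filter (fun σ => σ x = y ∧ σ⁻¹ x ∈ T)).card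
      + T.card * ((n - 1) * numDerangements (n - 2)) = T.card * numDerangements n := by
  have const : ∀ b c, b ≠ x → b ≠ y → c ≠ x → c ≠ y →
      ((derangeSet n).filter (fun σ => σ x = y ∧ σ⁻¹ x = b)).card =
        ((derangeSet n).filter (fun σ => σ x = y ∧ σ⁻¹ x = c)).card := by
    intro b c hbx hby hcx hcy
    refine card_filter_derangeSet_conj (swap b c) _ _ fun σ _ => ?_
    simp [swap_apply_of_ne_of_ne hbx.symm hcx.symm, swap_apply_eq_iff,
      swap_apply_of_ne_of_ne hby.symm hcy.symm, mul_assoc]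
  have hsum : ∀ U : Finset (Fin n), x ∉ U → y ∉ U → ∀ b, b ≠ x → b ≠ y →
      ((derangeSet n).filter (fun σ => σ x = y ∧ σ⁻¹ x ∈ U)).card =
        U.card * ((derangeSet n).filter (fun σ => σ x = y ∧ σ⁻¹ x = b)).card := by
    intro U hxU hyU b hbx hby
    rw [card_eq_sum_card_fiberwise (f := fun σ : Perm (Fin n) => σ⁻¹ x) (t := U)
      (fun σ hσ => (mem_filter.1 hσ).2.2)]
    refine sum_const_nat fun c hc => ?_
    rw [← const c b (fun h => hxU (h ▸ hc)) (fun h => hyU (h ▸ hc)) hbx hby, filter_filter]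
    congr 1
    refine filter_congr fun σ _ => ?_
    constructor
    · rintro ⟨⟨h1, _⟩, h2⟩
      exact ⟨h1, h2⟩
    · rintro ⟨h1, h2⟩
      exact ⟨⟨h1, h2 ▸ hc⟩, h2⟩
  rcases T.eq_empty_or_nonempty with rfl | ⟨b, hb⟩
  · simp
  have hbx : b ≠ x := fun h => hx (h ▸ hb)
  have hby : b ≠ y := fun h => hy (h ▸ hb)
  have hU : (({x, y} : Finset (Fin n))ᶜ).card = n - 2 := by
    rw [card_compl, card_pair hxy, Fintype.card_fin]
  have split : ((derangeSet n).filter (fun σ => σ x = y)).card =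
      (n - 2) * ((derangeSet n).filter (fun σ => σ x = y ∧ σ⁻¹ x = b)).card
        + numDerangements (n - 2) := by
    rw [← card_filter_swap hxy, ← hU, ← hsum _ (by simp) (by simp) b hbx hby,
      ← card_filter_add_card_filter_not (s := (derangeSet n).filter (fun σ => σ x = y))
        (fun σ => σ⁻¹ x ∈ (({x, y} : Finset (Fin n))ᶜ)), filter_filter, filter_filter]
    congr 2
    refine filter_congr fun σ hσ => ?_
    have h0 : σ⁻¹ x ≠ x := fun h => mem_derangeSet.1 hσ x (Perm.inv_eq_iff_eq.1 h).symm
    simp only [mem_compl, mem_insert, mem_singleton, not_not, h0, false_or]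
    rw [Perm.inv_eq_iff_eq, eq_comm (a := x)]
  rw [← card_filter_apply_eq hxy, split, hsum T hx hy b hbx hby]
  ring

/-- Derangements for which neither of `x`, `y` is the image of the other are equally likely to
have `x` before `y` as `y` before `x`. -/
theorem two_mul_card_filter_inv_lt {n : ℕ} {x y : Fin n} (hxy : x ≠ y) :
    2 * ((derangeSet n).filter (fun σ => (σ x ≠ y ∧ σ y ≠ x) ∧ σ⁻¹ x < σ⁻¹ y)).card =
      ((derangeSet n).filter (fun σ => σ x ≠ y ∧ σ y ≠ x)).card := by
  rw [← card_filter_add_card_filter_not (s := (derangeSet n).filter (fun σ => σ x ≠ y ∧ σ y ≠ x))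
    (fun σ => σ⁻¹ x < σ⁻¹ y), filter_filter, filter_filter, two_mul]
  congr 1
  refine card_filter_derangeSet_conj (swap x y) _ _ fun σ hσ => ?_
  have hd : ∀ z, σ⁻¹ z ≠ z := fun z h => mem_derangeSet.1 hσ z (Perm.inv_eq_iff_eq.1 h).symm
  have e1 : (swap x y * σ * (swap x y)⁻¹) x ≠ y ↔ σ y ≠ x := by simp [swap_apply_eq_iff]
  have e2 : (swap x y * σ * (swap x y)⁻¹) y ≠ x ↔ σ x ≠ y := by simp [swap_apply_eq_iff]
  rw [e1, e2, and_comm (a := σ y ≠ x)]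
  refine and_congr_right fun ⟨h1, h2⟩ => ?_
  have h3 : σ⁻¹ y ≠ x := fun h => h1 (Perm.inv_eq_iff_eq.1 h).symm
  have h4 : σ⁻¹ x ≠ y := fun h => h2 (Perm.inv_eq_iff_eq.1 h).symm
  have e3 : (swap x y * σ * (swap x y)⁻¹)⁻¹ x = σ⁻¹ y := by
    simpa [mul_assoc] using swap_apply_of_ne_of_ne h3 (hd y)
  have e4 : (swap x y * σ * (swap x y)⁻¹)⁻¹ y = σ⁻¹ x := by
    simpa [mul_assoc] using swap_apply_of_ne_of_ne (hd x) h4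
  rw [e3, e4, not_lt]
  exact ⟨le_of_lt, fun h => lt_of_le_of_ne h fun h => hxy (σ⁻¹.injective h)⟩

/-- Inclusion-exclusion for the two events that one of `x`, `y` is sent to the other. -/
theorem card_filter_neither {n : ℕ} {x y : Fin n} (hxy : x ≠ y) :
    ((derangeSet n).filter (fun σ => σ x = y)).card
      + ((derangeSet n).filter (fun σ => σ y = x)).card
      + ((derangeSet n).filter (fun σ => σ x ≠ y ∧ σ y ≠ x)).card
      = numDerangements n + numDerangements (n - 2) := by
  rw [← card_filter_swap hxy, ← numDerange_eq_numDerangements, numDerange]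
  simp only [card_filter, card_eq_sum_ones (derangeSet n), ← sum_add_distrib]
  refine sum_congr rfl fun σ _ => ?_
  by_cases h1 : σ x = y <;> by_cases h2 : σ y = x <;> simp [h1, h2]

theorem card_filter_inv_lt_split {n : ℕ} {x y : Fin n} (hxy : x < y) :
    ((derangeSet n).filter (fun σ => σ⁻¹ x < σ⁻¹ y)).card =
      ((derangeSet n).filter (fun σ => (σ x ≠ y ∧ σ y ≠ x) ∧ σ⁻¹ x < σ⁻¹ y)).card
      + ((derangeSet n).filter (fun σ => σ x = y ∧ σ⁻¹ x ∈ Iio x)).card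
      + ((derangeSet n).filter (fun σ => σ y = x ∧ σ⁻¹ y ∈ Ioi y)).card := by
  simp only [card_filter, ← sum_add_distrib]
  refine sum_congr rfl fun σ _ => ?_
  by_cases h1 : σ x = y <;> by_cases h2 : σ y = x
  · have h3 : σ⁻¹ x = y := Perm.inv_eq_iff_eq.2 h2.symm
    have h4 : σ⁻¹ y = x := Perm.inv_eq_iff_eq.2 h1.symm
    simp [h1, h2, h3, h4, hxy.le]
  · have h4 : σ⁻¹ y = x := Perm.inv_eq_iff_eq.2 h1.symm
    simp [h1, h2, h4]
  · have h3 : σ⁻¹ x = y := Perm.inv_eq_iff_eq.2 h2.symm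
    simp [h1, h2, h3]
  · simp [h1, h2]

theorem numDerangements_eq_factorial_mul_sum (n : ℕ) :
    (numDerangements n : ℝ) =
      (n.factorial : ℝ) * ∑ l ∈ range (n + 1), (-1 : ℝ) ^ l / (l.factorial : ℝ) := by
  induction n with
  | zero => simp
  | succ n ih =>
    have h : (numDerangements (n + 1) : ℝ) = (n + 1) * (numDerangements n : ℝ) - (-1) ^ n := by
      exact_mod_cast numDerangements_succ n
    have hf : ((n + 1).factorial : ℝ) ≠ 0 := by positivity
    rw [h, ih, sum_range_succ _ (n + 1), mul_add, mul_div_cancel₀ _ hf, Nat.factorial_succ]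
    push_cast
    ring

/-- The probability that `i` precedes `j` in a uniformly random derangement of `{1,…,n}`.
The number `i ∈ {1,…,n}` is represented by `⟨i-1, _⟩ : Fin n`, and `σ⁻¹ i` is the
(0-based) position of `i` in the one-line notation of `σ`. -/
theorem stmt1 (n i j : ℕ) (hn : 3 ≤ n) (hi : 1 ≤ i) (hij : i < j) (hj : j ≤ n) :
    ((numDerange n : ℝ))⁻¹ *
        (((derangeSet n).filter
            (fun σ => σ⁻¹ (⟨i - 1, by omega⟩ : Fin n) < σ⁻¹ (⟨j - 1, by omega⟩ : Fin n))).card : ℝ) =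
      1 / 2 +
        ((1 - 2 * ((j : ℝ) - (i : ℝ))) * (n : ℝ) + 2 * ((j : ℝ) - (i : ℝ))) /
          (2 * (n : ℝ) * ((n : ℝ) - 1) * ((n : ℝ) - 2)) +
        ((-1 : ℝ) ^ n / (Nat.factorial n : ℝ)) /
            (∑ l ∈ Finset.range (n + 1), (-1 : ℝ) ^ l / (Nat.factorial l : ℝ)) *
          ((2 * ((j : ℝ) - (i : ℝ)) - (n : ℝ)) / (2 * (n : ℝ) * ((n : ℝ) - 2))) := by
  obtain ⟨m, rfl⟩ : ∃ m, n = m + 3 := ⟨n - 3, by omega⟩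
  set x : Fin (m + 3) := ⟨i - 1, by omega⟩ with hxd
  set y : Fin (m + 3) := ⟨j - 1, by omega⟩ with hyd
  have hxy : x < y := by
    rw [Fin.lt_def]
    simp only [hxd, hyd]
    omega
  have h1 := card_filter_apply_eq hxy.ne
  have h2 := card_filter_apply_eq hxy.ne'
  have h3 := card_filter_apply_eq_inv_mem hxy.ne (Iio x) (by simp) (by simpa using hxy.le)
  have h4 := card_filter_apply_eq_inv_mem hxy.ne' (Ioi y) (by simp) (by simpa using hxy.le)
  have h5 := two_mul_card_filter_inv_lt hxy.ne
  have h6 := card_filter_neither hxy.ne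
  have h7 := card_filter_inv_lt_split hxy
  have hX : (Iio x).card + 1 = i := by
    rw [Fin.card_Iio]
    simp only [hxd]
    omega
  have hY : (Ioi y).card + j = m + 3 := by
    rw [Fin.card_Ioi]
    simp only [hyd]
    omega
  have hS := numDerangements_eq_factorial_mul_sum (m + 3)
  have r1 : (numDerangements (m + 3) : ℝ) =
      (m + 3) * (numDerangements (m + 2) : ℝ) + (-1) ^ (m + 3) := by
    have := numDerangements_succ (m + 2)
    have h : (numDerangements (m + 2 + 1) : ℝ) =
        ((m + 2 : ℕ) + 1) * (numDerangements (m + 2) : ℝ) - (-1) ^ (m + 2) := by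
      exact_mod_cast this
    rw [h]
    push_cast
    ring
  have r2 : (numDerangements (m + 2) : ℝ) =
      (m + 2) * (numDerangements (m + 1) : ℝ) - (-1) ^ (m + 3) := by
    have := numDerangements_succ (m + 1)
    have h : (numDerangements (m + 1 + 1) : ℝ) =
        ((m + 1 : ℕ) + 1) * (numDerangements (m + 1) : ℝ) - (-1) ^ (m + 1) := by
      exact_mod_cast this
    rw [h]
    push_cast
    ring
  have hpos : (numDerangements (m + 3) : ℝ) ≠ 0 := by
    have hp : ∀ k, 0 < numDerangements (k + 2) := by
      intro k
      induction k with
      | zero => decide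
      | succ k ih =>
        rw [numDerangements_add_two]
        positivity
    exact_mod_cast (hp (m + 1)).ne'
  rw [numDerange_eq_numDerangements, h7]
  have hf : ((m + 3).factorial : ℝ) ≠ 0 := by positivity
  have hratio : ((-1 : ℝ) ^ (m + 3) / ((m + 3).factorial : ℝ)) /
      (∑ l ∈ range (m + 3 + 1), (-1 : ℝ) ^ l / (l.factorial : ℝ)) =
      (-1 : ℝ) ^ (m + 3) / (numDerangements (m + 3) : ℝ) := by
    rw [hS, div_div]
  rw [hratio]
  simp only [show m + 3 - 1 = m + 2 by omega, show m + 3 - 2 = m + 1 by omega] at h1 h2 h3 h4 h6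
  generalize (Iio x).card = p at *
  generalize (Ioi y).card = q at *
  generalize ((derangeSet (m + 3)).filter (fun σ => σ x = y)).card = a at *
  generalize ((derangeSet (m + 3)).filter (fun σ => σ y = x)).card = b at *
  generalize ((derangeSet (m + 3)).filter
    (fun σ => (σ x ≠ y ∧ σ y ≠ x) ∧ σ⁻¹ x < σ⁻¹ y)).card = t at *
  generalize ((derangeSet (m + 3)).filter (fun σ => σ x ≠ y ∧ σ y ≠ x)).card = w at *
  generalize ((derangeSet (m + 3)).filter (fun σ => σ x = y ∧ σ⁻¹ x ∈ Iio x)).card = u at *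
  generalize ((derangeSet (m + 3)).filter (fun σ => σ y = x ∧ σ⁻¹ y ∈ Ioi y)).card = v at *
  generalize numDerangements (m + 3) = D at *
  generalize numDerangements (m + 2) = E at *
  generalize numDerangements (m + 1) = S at *
  generalize (-1 : ℝ) ^ (m + 3) = ε at *
  rify at h1 h2 h3 h4 h5 h6 hX hY
  have m1 : (m : ℝ) + 1 ≠ 0 := by positivity
  have m2 : (m : ℝ) + 2 ≠ 0 := by positivity
  have m3 : (m : ℝ) + 3 ≠ 0 := by positivity
  have ea : (a : ℝ) = D / (m + 2) := by
    rw [eq_div_iff m2]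
    linarith
  have eb : (b : ℝ) = D / (m + 2) := by
    rw [eq_div_iff m2]
    linarith
  have eS : (S : ℝ) = (D + (m + 2) * ε) / ((m + 2) * (m + 3)) := by
    rw [eq_div_iff (mul_ne_zero m2 m3), r1, r2]
    ring
  have eu : (u : ℝ) = p * (D - (m + 2) * S) / ((m + 2) * (m + 1)) := by
    rw [eq_div_iff (mul_ne_zero m2 m1)]
    linarith
  have ev : (v : ℝ) = q * (D - (m + 2) * S) / ((m + 2) * (m + 1)) := by
    rw [eq_div_iff (mul_ne_zero m2 m1)]
    linarith
  have et : (t : ℝ) = (D + S - a - b) / 2 := by linarith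
  have ei : (i : ℝ) = p + 1 := hX.symm
  have ej : (j : ℝ) = m + 3 - q := by linarith
  push_cast
  rw [et, eu, ev, ea, eb, eS, ei, ej, show (m : ℝ) + 3 - 1 = m + 2 by ring,
    show (m : ℝ) + 3 - 2 = m + 1 by ring]
  field_simp
  ring
end

section
/- Let n ≥ 3, let 1 ≤ k ≤ n−2, and let 1 ≤ i < j ≤ n. Set r = ((−1)^{n−k}/(n−k)!)/(∑_{l=0}^{n−k} (−1)^l/l!) and s = ((−1)^{n−k−1}/(n−k−1)! + (−1)^{n−k}/(n−k)!)/(∑_{l=0}^{n−k} (−1)^l/l!). Then (1/d_{n,k})·#{σ ∈ D_{n,k} : σ⁻¹(i) < σ⁻¹(j)} = k·[(k−1)/(n(n−1)) + (n−k)(j−2)/(n(n−1)(n−2))] + (1 − r)·[k(n−k−1)(n−i−1)/(n(n−1)(n−2)) + (n−k−1)·(i−1+n−j+(n−2)(n−3−k)/2)/(n(n−1)(n−2))] + (1/(k+1))·(1 − s)·[(k+1)k(n−i−1)/(n(n−1)(n−2)) + (n−2−k)(k+1)/(2n(n−1))]. -/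
open Equiv

/-- The number of permutations of `Fin n` with exactly `k` fixed points that send `i` to `a` and
`j` to `b`. -/
def pairCount (n k : ℕ) (i j a b : Fin n) : ℕ :=
  ((permsWithFixed n k).filter (fun τ => τ i = a ∧ τ j = b)).card

theorem mem_permsWithFixed {n k : ℕ} {σ : Perm (Fin n)} :
    σ ∈ permsWithFixed n k ↔ fixedPointCount σ = k := by
  simp [permsWithFixed]

theorem fixedPointCount_conj {n : ℕ} (g τ : Perm (Fin n)) :
    fixedPointCount (g * τ * g⁻¹) = fixedPointCount τ := by
  unfold fixedPointCount
  refine Finset.card_bij' (fun x _ => g⁻¹ x) (fun x _ => g x) ?_ ?_ ?_ ?_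
  · intro x hx
    rw [Finset.mem_filter] at hx ⊢
    exact ⟨Finset.mem_univ _, Perm.eq_inv_iff_eq.2 hx.2⟩
  · intro x hx
    rw [Finset.mem_filter] at hx ⊢
    simpa using hx.2
  · simp
  · simp

theorem fixedPointCount_inv {n : ℕ} (τ : Perm (Fin n)) :
    fixedPointCount τ⁻¹ = fixedPointCount τ := by
  unfold fixedPointCount
  congr 1
  ext x
  rw [Finset.mem_filter, Finset.mem_filter, Perm.inv_eq_iff_eq, eq_comm]

theorem pairCount_conj {n k : ℕ} (g : Perm (Fin n)) (i j a b : Fin n) :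
    pairCount n k (g i) (g j) (g a) (g b) = pairCount n k i j a b := by
  unfold pairCount
  refine (Finset.card_bij' (fun τ _ => g * τ * g⁻¹) (fun τ _ => g⁻¹ * τ * g) ?_ ?_ ?_ ?_).symm
  · intro τ hτ
    simpa [mem_permsWithFixed, fixedPointCount_conj] using hτ
  · intro τ hτ
    have := fixedPointCount_conj g⁻¹ τ
    rw [inv_inv] at this
    simpa [mem_permsWithFixed, this, symm_apply_eq] using hτ
  · intro τ _
    group
  · intro τ _
    group

theorem pairCount_comm {n k : ℕ} (i j a b : Fin n) :
    pairCount n k i j a b = pairCount n k j i b a := by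
  simp only [pairCount, and_comm]

theorem pairCount_eq_zero {n k : ℕ} {i j : Fin n} (h : i ≠ j) (a : Fin n) :
    pairCount n k i j a a = 0 := by
  rw [pairCount, Finset.card_eq_zero, Finset.filter_eq_empty_iff]
  rintro τ - ⟨h₁, h₂⟩
  exact h (τ.injective (h₁.trans h₂.symm))

theorem sum_pairCount {n k : ℕ} (i j a : Fin n) :
    ∑ b, pairCount n k i j a b = pairCount n k i i a a := by
  unfold pairCount
  rw [Finset.card_eq_sum_card_fiberwise (f := fun τ => τ j) (t := Finset.univ) (by simp)]
  simp [Finset.filter_filter]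

theorem sum_pairCount_diag {n k : ℕ} (i : Fin n) :
    ∑ a, pairCount n k i i a a = numPermsWithFixed n k := by
  unfold pairCount numPermsWithFixed
  rw [Finset.card_eq_sum_card_fiberwise (f := fun τ => τ i) (t := Finset.univ)
    (s := permsWithFixed n k) (by simp)]
  simp

theorem sum_card_filter_fixed {n k : ℕ} (T : Finset (Perm (Fin n)))
    (hT : T ⊆ permsWithFixed n k) :
    ∑ x, (T.filter (fun τ => τ x = x)).card = k * T.card := by
  simp only [Finset.card_filter]
  rw [Finset.sum_comm, mul_comm, ← smul_eq_mul, ← Finset.sum_const]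
  refine Finset.sum_congr rfl fun τ hτ => ?_
  rw [← Finset.card_filter]
  exact mem_permsWithFixed.1 (hT hτ)

theorem mul_pairCount_fixed {n k : ℕ} (i : Fin n) :
    n * pairCount n k i i i i = k * numPermsWithFixed n k := by
  rw [numPermsWithFixed, ← sum_card_filter_fixed _ subset_rfl]
  rw [Finset.sum_congr rfl (g := fun _ => pairCount n k i i i i)]
  · simp
  · intro x _
    rw [← pairCount_conj (swap x i) i i i i]
    simp [pairCount]

theorem add_mul_pairCount_moved {n k : ℕ} {i j : Fin n} (h : i ≠ j) :
    pairCount n k i i i i + (n - 1) * pairCount n k i i j j = numPermsWithFixed n k := by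
  rw [← sum_pairCount_diag i, ← Finset.add_sum_erase _ _ (Finset.mem_univ i)]
  rw [Finset.sum_congr rfl (g := fun _ => pairCount n k i i j j)]
  · simp
  · intro x hx
    have hx' : i ≠ x := (Finset.ne_of_mem_erase hx).symm
    rw [← pairCount_conj (swap x j) i i j j, swap_apply_of_ne_of_ne hx' h, swap_apply_right]

theorem add_mul_pairCount_fixed_fixed {n k : ℕ} {i j : Fin n} (h : i ≠ j) :
    pairCount n k i i i i + (n - 1) * pairCount n k i j i j = k * pairCount n k i i i i := by
  have key := sum_card_filter_fixed ((permsWithFixed n k).filter (fun τ => τ i = i ∧ τ i = i))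
    (Finset.filter_subset _ _)
  rw [← pairCount] at key
  rw [← key, ← Finset.add_sum_erase _ _ (Finset.mem_univ i)]
  rw [Finset.sum_congr rfl (g := fun _ => pairCount n k i j i j)]
  · simp [pairCount, Finset.filter_filter]
  · intro x hx
    have hx' : i ≠ x := (Finset.ne_of_mem_erase hx).symm
    rw [← pairCount_conj (swap x j) i j i j, swap_apply_of_ne_of_ne hx' h, swap_apply_right]
    simp [pairCount, Finset.filter_filter]

theorem add_mul_pairCount_generic {n k : ℕ} {i j a c b : Fin n} (h : i ≠ j)
    (hac : a = i ∧ c = j ∨ a = j ∧ c = i) (hi : b ≠ i) (hj : b ≠ j) :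
    pairCount n k i j a c + (n - 2) * pairCount n k i j a b = pairCount n k i i a a := by
  have hne : a ≠ c := by rcases hac with ⟨rfl, rfl⟩ | ⟨rfl, rfl⟩ <;> simp [h, h.symm]
  rw [← sum_pairCount i j a, ← Finset.add_sum_erase _ _ (Finset.mem_univ a),
    ← Finset.add_sum_erase _ _ (Finset.mem_erase.2 ⟨hne.symm, Finset.mem_univ c⟩),
    pairCount_eq_zero h, zero_add]
  rw [Finset.sum_congr rfl (g := fun _ => pairCount n k i j a b)]
  · simp [Finset.card_erase_of_mem, hne.symm, Nat.sub_sub]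
  · intro x hx
    have hxc : x ≠ c := Finset.ne_of_mem_erase hx
    have hxa : x ≠ a := Finset.ne_of_mem_erase (Finset.mem_of_mem_erase hx)
    have hxi : i ≠ x := by rcases hac with ⟨rfl, rfl⟩ | ⟨rfl, rfl⟩ <;> simp [hxc.symm, hxa.symm]
    have hxj : j ≠ x := by rcases hac with ⟨rfl, rfl⟩ | ⟨rfl, rfl⟩ <;> simp [hxc.symm, hxa.symm]
    have hba : a ≠ b := by rcases hac with ⟨rfl, rfl⟩ | ⟨rfl, rfl⟩ <;> simp [hi.symm, hj.symm]
    rw [← pairCount_conj (swap x b) i j a b, swap_apply_of_ne_of_ne hxi hi.symm,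
      swap_apply_of_ne_of_ne hxj hj.symm, swap_apply_of_ne_of_ne hxa.symm hba, swap_apply_right]

theorem fixedPointCount_swap_mul {n : ℕ} {i j : Fin n} (h : i ≠ j) {τ : Perm (Fin n)}
    (hi : τ i = j) (hj : τ j = i) :
    fixedPointCount (swap i j * τ) = fixedPointCount τ + 2 := by
  unfold fixedPointCount
  have : (Finset.univ.filter fun x => (swap i j * τ) x = x) =
      insert i (insert j (Finset.univ.filter fun x => τ x = x)) := by
    ext x
    rw [Finset.mem_filter, Finset.mem_insert, Finset.mem_insert, Finset.mem_filter,
      Perm.mul_apply]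
    by_cases hxi : x = i
    · simp [hxi, hi]
    by_cases hxj : x = j
    · simp [hxj, hj]
    have h₁ : τ x ≠ j := fun e => hxi (τ.injective (e.trans hi.symm))
    have h₂ : τ x ≠ i := fun e => hxj (τ.injective (e.trans hj.symm))
    rw [swap_apply_of_ne_of_ne h₂ h₁]
    simp [hxi, hxj]
  rw [this, Finset.card_insert_of_notMem, Finset.card_insert_of_notMem]
  · simp [hj, h]
  · simp [hi, h, h.symm]

theorem pairCount_swapped {n k : ℕ} {i j : Fin n} (h : i ≠ j) :
    pairCount n k i j j i = pairCount n (k + 2) i j i j := by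
  unfold pairCount
  refine Finset.card_bij' (fun τ _ => swap i j * τ) (fun τ _ => swap i j * τ) ?_ ?_ ?_ ?_
  · intro τ hτ
    simp only [Finset.mem_filter, mem_permsWithFixed] at hτ ⊢
    obtain ⟨h₀, h₁, h₂⟩ := hτ
    simp [fixedPointCount_swap_mul h h₁ h₂, h₀, h₁, h₂]
  · intro τ hτ
    simp only [Finset.mem_filter, mem_permsWithFixed] at hτ ⊢
    obtain ⟨h₀, h₁, h₂⟩ := hτ
    have := fixedPointCount_swap_mul h (τ := swap i j * τ) (by simp [h₁]) (by simp [h₂])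
    rw [swap_mul_self_mul, h₀] at this
    simp [h₁, h₂]
    omega
  · simp
  · simp

theorem numPermsWithFixed_eq (n k : ℕ) :
    numPermsWithFixed n k = n.choose k * numDerangements (n - k) := by
  classical
  unfold numPermsWithFixed
  rw [Finset.card_eq_sum_card_fiberwise (f := fun τ => Finset.univ.filter (fun x => τ x = x))
    (t := Finset.univ.powersetCard k)]
  · rw [Finset.sum_congr rfl (g := fun _ => numDerangements (n - k))]
    · simp
    · intro S hS
      have hS' : S.card = k := (Finset.mem_powersetCard.1 hS).2
      have e := Fintype.card_congr (derangements.subtypeEquiv (fun x : Fin n => x ∉ S))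
      rw [card_derangements_eq_numDerangements] at e
      simp only [Fintype.card_subtype_compl, Fintype.card_fin, Fintype.card_coe, hS'] at e
      rw [e, Fintype.card_subtype]
      congr 1
      ext τ
      simp only [Finset.mem_filter, mem_permsWithFixed, Finset.mem_univ, true_and, not_not,
        Function.mem_fixedPoints, Function.IsFixedPt, fixedPointCount, Finset.ext_iff]
      constructor
      · exact fun hτ a => (hτ.2 a).symm
      · intro hτ
        refine ⟨?_, fun a => (hτ a).symm⟩
        rw [← hS']
        congr 1
        ext a
        simp [hτ a]
  · intro τ hτ
    exact Finset.mem_powersetCard.2 ⟨Finset.subset_univ _, mem_permsWithFixed.1 hτ⟩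

theorem numDerangements_eq_factorial_mul (m : ℕ) :
    (numDerangements m : ℝ) =
      m.factorial * ∑ l ∈ Finset.range (m + 1), (-1 : ℝ) ^ l / (l.factorial : ℝ) := by
  have h := congrArg (Int.cast : ℤ → ℝ) (numDerangements_sum m)
  push_cast at h
  rw [h, Finset.mul_sum]
  refine Finset.sum_congr rfl fun l hl => ?_
  have hl' : l ≤ m := Nat.lt_succ_iff.1 (Finset.mem_range.1 hl)
  have := Nat.factorial_mul_ascFactorial l (m - l)
  rw [Nat.add_sub_cancel' hl'] at this
  rw [← this]
  have := Nat.factorial_ne_zero l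
  push_cast
  field_simp

theorem numDerangements_add_two_pos (m : ℕ) : 0 < numDerangements (m + 2) := by
  induction m with
  | zero => decide
  | succ m ih =>
    rw [numDerangements_add_two]
    positivity

theorem numPermsWithFixed_eq_div {n k : ℕ} (h : k ≤ n) :
    (numPermsWithFixed n k : ℝ) = n.factorial / k.factorial *
      ∑ l ∈ Finset.range (n - k + 1), (-1 : ℝ) ^ l / (l.factorial : ℝ) := by
  rw [numPermsWithFixed_eq, Nat.cast_mul, numDerangements_eq_factorial_mul,
    Nat.cast_choose ℝ h]
  have := Nat.factorial_ne_zero (n - k)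
  field_simp

theorem numPermsWithFixed_add_two {n k : ℕ} (h : k + 2 ≤ n) :
    ((k : ℝ) + 2) * (k + 1) * numPermsWithFixed n (k + 2) *
        ∑ l ∈ Finset.range (n - k + 1), (-1 : ℝ) ^ l / (l.factorial : ℝ) =
      numPermsWithFixed n k *
        ∑ l ∈ Finset.range (n - k - 1), (-1 : ℝ) ^ l / (l.factorial : ℝ) := by
  rw [numPermsWithFixed_eq_div h, numPermsWithFixed_eq_div (by omega : k ≤ n),
    show n - (k + 2) + 1 = n - k - 1 by omega]
  have := Nat.factorial_ne_zero k
  rw [Nat.factorial_succ (k + 1), Nat.factorial_succ k]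
  push_cast
  have : (k : ℝ) + 2 ≠ 0 := by positivity
  have : (k : ℝ) + 1 + 1 ≠ 0 := by positivity
  field_simp
  ring

theorem sum_alternating_ne_zero {m : ℕ} (h : 2 ≤ m) :
    ∑ l ∈ Finset.range (m + 1), (-1 : ℝ) ^ l / (l.factorial : ℝ) ≠ 0 := by
  obtain ⟨m, rfl⟩ := Nat.exists_eq_add_of_le' h
  intro h0
  have h1 := numDerangements_eq_factorial_mul (m + 2)
  rw [h0, mul_zero, Nat.cast_eq_zero] at h1
  exact (numDerangements_add_two_pos m).ne' h1

/-- The sign of `b - a`. -/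
def orderSign {n : ℕ} (a b : Fin n) : ℝ := if a < b then 1 else if b < a then -1 else 0

theorem orderSign_swap {n : ℕ} (a b : Fin n) : orderSign b a = -orderSign a b := by
  unfold orderSign
  split_ifs <;> first | omega | simp

theorem sum_orderSign {n : ℕ} (a : Fin n) : ∑ b, orderSign a b = (n : ℝ) - 1 - 2 * a := by
  have h : ∀ b, orderSign a b = (if a < b then 1 else 0) - (if b < a then 1 else 0) := by
    intro b
    unfold orderSign
    split_ifs <;> first | omega | simp
  have hn : a + 1 ≤ n := a.isLt
  simp only [h, Finset.sum_sub_distrib, Finset.sum_boole]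
  rw [Finset.filter_lt_eq_Ioi, Finset.filter_gt_eq_Iio, Fin.card_Ioi, Fin.card_Iio, Nat.sub_sub,
    add_comm 1, Nat.cast_sub hn]
  push_cast
  ring

theorem sum_sum_pairCount {n k : ℕ} (i j : Fin n) :
    ∑ a, ∑ b, pairCount n k i j a b = numPermsWithFixed n k := by
  simp only [sum_pairCount, sum_pairCount_diag]

theorem card_filter_lt_eq_sum {n k : ℕ} (i j : Fin n) :
    ((permsWithFixed n k).filter (fun τ => τ i < τ j)).card =
      ∑ a, ∑ b, if a < b then pairCount n k i j a b else 0 := by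
  rw [← Finset.sum_product' Finset.univ Finset.univ
      (fun a b => if a < b then pairCount n k i j a b else 0)]
  rw [Finset.card_eq_sum_card_fiberwise (f := fun τ => (τ i, τ j)) (t := Finset.univ)
    (by simp)]
  refine Finset.sum_congr (by simp) fun p _ => ?_
  rw [Finset.filter_filter]
  split_ifs with h
  · unfold pairCount
    congr 1
    ext τ
    simp only [Finset.mem_filter, Prod.ext_iff]
    grind
  · rw [Finset.card_eq_zero, Finset.filter_eq_empty_iff]
    rintro τ - ⟨h₁, rfl⟩
    exact h h₁

theorem two_mul_card_filter_lt {n k : ℕ} {i j : Fin n} (hij : i < j) {c e : ℝ}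
    (hc : (pairCount n k i j i j : ℝ) - pairCount n k i j j i = c)
    (hi : ∀ b, b ≠ i → b ≠ j → (pairCount n k i j i b : ℝ) - pairCount n k i j b i = e)
    (hj : ∀ b, b ≠ i → b ≠ j → (pairCount n k i j b j : ℝ) - pairCount n k i j j b = e) :
    2 * (((permsWithFixed n k).filter (fun τ => τ i < τ j)).card : ℝ) =
      numPermsWithFixed n k + c + 2 * ((j : ℝ) - i - 1) * e := by
  set N : Fin n → Fin n → ℝ := fun a b => pairCount n k i j a b with hN
  have hdiag : ∀ a, N a a = 0 := fun a => by simp [hN, pairCount_eq_zero hij.ne]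
  have hdiff : ∀ a b, N a b - N b a =
      e * ((if a = i then 1 else 0) - (if b = i then 1 else 0) + (if b = j then 1 else 0)
        - (if a = j then 1 else 0))
      + (c - 2 * e) * ((if a = i then 1 else 0) * (if b = j then 1 else 0)
        - (if a = j then 1 else 0) * (if b = i then 1 else 0)) := by
    have hne := hij.ne
    have hgen : ∀ a b, a ≠ i → a ≠ j → b ≠ i → b ≠ j → N a b = N b a := by
      intro a b ha₁ ha₂ hb₁ hb₂
      have := pairCount_conj (k := k) (swap a b) i j a b
      rw [swap_apply_of_ne_of_ne ha₁.symm hb₁.symm, swap_apply_of_ne_of_ne ha₂.symm hb₂.symm,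
        swap_apply_left, swap_apply_right] at this
      simp [hN, this]
    change N i j - N j i = c at hc
    change ∀ b, b ≠ i → b ≠ j → N i b - N b i = e at hi
    change ∀ b, b ≠ i → b ≠ j → N b j - N j b = e at hj
    intro a b
    split_ifs <;> subst_vars <;> grind
  have hX : 2 * (((permsWithFixed n k).filter (fun τ => τ i < τ j)).card : ℝ) -
      numPermsWithFixed n k = ∑ a, ∑ b, orderSign a b * N a b := by
    rw [card_filter_lt_eq_sum, ← sum_sum_pairCount i j]
    push_cast
    simp only [Finset.mul_sum, ← Finset.sum_sub_distrib]
    refine Finset.sum_congr rfl fun a _ => Finset.sum_congr rfl fun b _ => ?_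
    change 2 * (if a < b then N a b else 0) - N a b = _
    unfold orderSign
    have := hdiag a
    split_ifs with h₁ h₂
    · ring
    · ring
    · obtain rfl : a = b := le_antisymm (not_lt.1 h₂) (not_lt.1 h₁)
      simp [this]
  have hX' : ∑ a, ∑ b, orderSign a b * N a b = -∑ a, ∑ b, orderSign a b * N b a := by
    rw [Finset.sum_comm, ← Finset.sum_neg_distrib]
    refine Finset.sum_congr rfl fun a _ => ?_
    rw [← Finset.sum_neg_distrib]
    refine Finset.sum_congr rfl fun b _ => ?_
    rw [orderSign_swap]
    ring
  have hrow : ∀ x : Fin n, ∑ a, ∑ b, orderSign a b * (if a = x then 1 else 0) =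
      (n : ℝ) - 1 - 2 * x := by
    intro x
    rw [← sum_orderSign x]
    simp
  have hcol : ∀ x : Fin n, ∑ a, ∑ b, orderSign a b * (if b = x then 1 else 0) =
      -((n : ℝ) - 1 - 2 * x) := by
    intro x
    rw [← sum_orderSign x, ← Finset.sum_neg_distrib]
    simp [← orderSign_swap]
  have hpair : ∀ x y : Fin n, ∑ a, ∑ b, orderSign a b *
      ((if a = x then 1 else 0) * (if b = y then 1 else 0)) = orderSign x y := by
    intro x y
    simp
  have hsum : ∑ a, ∑ b, orderSign a b * (N a b - N b a) =
      e * (((n : ℝ) - 1 - 2 * i) + ((n : ℝ) - 1 - 2 * i) - ((n : ℝ) - 1 - 2 * j)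
        - ((n : ℝ) - 1 - 2 * j)) + (c - 2 * e) * (orderSign i j - orderSign j i) := by
    trans ∑ a, ∑ b, (e * (orderSign a b * (if a = i then 1 else 0)
        - orderSign a b * (if b = i then 1 else 0) + orderSign a b * (if b = j then 1 else 0)
        - orderSign a b * (if a = j then 1 else 0))
      + (c - 2 * e) * (orderSign a b * ((if a = i then 1 else 0) * (if b = j then 1 else 0))
        - orderSign a b * ((if a = j then 1 else 0) * (if b = i then 1 else 0))))
    · refine Finset.sum_congr rfl fun a _ => Finset.sum_congr rfl fun b _ => ?_
      rw [hdiff]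
      ring
    · simp only [Finset.sum_add_distrib, Finset.sum_sub_distrib, ← Finset.mul_sum]
      rw [hrow, hrow, hcol, hcol, hpair, hpair]
      ring
  simp only [mul_sub, Finset.sum_sub_distrib] at hsum
  rw [orderSign_swap i j, show orderSign i j = 1 by simp [orderSign, hij]] at hsum
  linarith

theorem pairCount_fixed_eq {n k : ℕ} (hn : 0 < n) (i : Fin n) :
    (pairCount n k i i i i : ℝ) = k * numPermsWithFixed n k / n := by
  have h := congrArg (Nat.cast : ℕ → ℝ) (mul_pairCount_fixed (k := k) i)
  push_cast at h
  field_simp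
  linarith

theorem pairCount_moved_eq {n k : ℕ} (hn : 1 < n) {i j : Fin n} (h : i ≠ j) :
    (pairCount n k i i j j : ℝ) = (n - k) * numPermsWithFixed n k / (n * (n - 1)) := by
  have h₁ := congrArg (Nat.cast : ℕ → ℝ) (add_mul_pairCount_moved (k := k) h)
  push_cast [Nat.cast_sub hn.le] at h₁
  rw [pairCount_fixed_eq (by omega)] at h₁
  have : (n : ℝ) - 1 ≠ 0 := sub_ne_zero.2 (by exact_mod_cast hn.ne')
  have : (n : ℝ) ≠ 0 := by positivity
  field_simp at h₁ ⊢
  linarith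

theorem pairCount_fixed_fixed_eq {n k : ℕ} (hn : 1 < n) {i j : Fin n} (h : i ≠ j) :
    (pairCount n k i j i j : ℝ) = k * (k - 1) * numPermsWithFixed n k / (n * (n - 1)) := by
  have h₁ := congrArg (Nat.cast : ℕ → ℝ) (add_mul_pairCount_fixed_fixed (k := k) h)
  push_cast [Nat.cast_sub hn.le] at h₁
  rw [pairCount_fixed_eq (by omega)] at h₁
  have : (n : ℝ) - 1 ≠ 0 := sub_ne_zero.2 (by exact_mod_cast hn.ne')
  have : (n : ℝ) ≠ 0 := by positivity
  field_simp at h₁ ⊢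
  linarith

theorem pairCount_generic_eq {n k : ℕ} (hn : 2 < n) {i j a c b : Fin n} (h : i ≠ j)
    (hac : a = i ∧ c = j ∨ a = j ∧ c = i) (hi : b ≠ i) (hj : b ≠ j) :
    (pairCount n k i j a b : ℝ) =
      ((pairCount n k i i a a : ℝ) - pairCount n k i j a c) / (n - 2) := by
  have h₁ := congrArg (Nat.cast : ℕ → ℝ) (add_mul_pairCount_generic (k := k) h hac hi hj)
  push_cast [Nat.cast_sub hn.le] at h₁
  have : (n : ℝ) - 2 ≠ 0 := sub_ne_zero.2 (by exact_mod_cast hn.ne')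
  field_simp
  linarith

theorem two_mul_card_filter_lt_eq {n k : ℕ} (hn : 2 < n) {i j : Fin n} (hij : i < j) :
    2 * (((permsWithFixed n k).filter (fun τ => τ i < τ j)).card : ℝ) =
      numPermsWithFixed n k +
      (k * (k - 1) * numPermsWithFixed n k -
        (k + 2) * (k + 1) * numPermsWithFixed n (k + 2)) / (n * (n - 1)) +
      2 * ((j : ℝ) - i - 1) *
        ((k * (n - k) - (n - k)) * numPermsWithFixed n k +
          (k + 2) * (k + 1) * numPermsWithFixed n (k + 2)) / (n * (n - 1) * (n - 2)) := by
  have hne := hij.ne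
  have hn₁ : (n : ℝ) - 1 ≠ 0 := sub_ne_zero.2 (by exact_mod_cast (by omega : n ≠ 1))
  have hn₂ : (n : ℝ) - 2 ≠ 0 := sub_ne_zero.2 (by exact_mod_cast hn.ne')
  have hn₀ : (n : ℝ) ≠ 0 := by positivity
  rw [two_mul_card_filter_lt hij rfl (e := ((k * (n - k) - (n - k)) * numPermsWithFixed n k +
    (k + 2) * (k + 1) * numPermsWithFixed n (k + 2)) / (n * (n - 1) * (n - 2)))]
  · rw [pairCount_swapped hne, pairCount_fixed_fixed_eq (by omega) hne,
      pairCount_fixed_fixed_eq (by omega) hne]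
    push_cast
    field_simp
    ring
  · intro b hi hj
    rw [pairCount_comm i j b i, pairCount_generic_eq hn hne (Or.inl ⟨rfl, rfl⟩) hi hj,
      pairCount_generic_eq hn hne.symm (Or.inr ⟨rfl, rfl⟩) hj hi, pairCount_swapped hne.symm,
      pairCount_fixed_eq (by omega), pairCount_moved_eq (by omega) hne.symm,
      pairCount_fixed_fixed_eq (by omega) hne, pairCount_fixed_fixed_eq (by omega) hne.symm]
    push_cast
    field_simp
    ring
  · intro b hi hj
    rw [pairCount_comm i j b j, pairCount_generic_eq hn hne (Or.inr ⟨rfl, rfl⟩) hi hj,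
      pairCount_generic_eq hn hne.symm (Or.inl ⟨rfl, rfl⟩) hj hi, pairCount_swapped hne,
      pairCount_fixed_eq (by omega), pairCount_moved_eq (by omega) hne,
      pairCount_fixed_fixed_eq (by omega) hne, pairCount_fixed_fixed_eq (by omega) hne.symm]
    push_cast
    field_simp
    ring

theorem card_filter_inv_lt {n k : ℕ} (i j : Fin n) :
    ((permsWithFixed n k).filter (fun σ => σ⁻¹ i < σ⁻¹ j)).card =
      ((permsWithFixed n k).filter (fun τ => τ i < τ j)).card := by
  refine Finset.card_bij' (fun σ _ => σ⁻¹) (fun σ _ => σ⁻¹) ?_ ?_ ?_ ?_ <;> intro σ hσ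
  · simpa only [Finset.mem_filter, mem_permsWithFixed, fixedPointCount_inv] using hσ
  · simpa only [Finset.mem_filter, mem_permsWithFixed, fixedPointCount_inv, inv_inv] using hσ
  · simp
  · simp

/-- The probability that `i` precedes `j` in a uniformly random permutation of `{1,…,n}`
with exactly `k` fixed points, expressed via `r` and `s`. -/
theorem stmt3 (n k i j : ℕ) (hn : 3 ≤ n) (hk1 : 1 ≤ k) (hk2 : k ≤ n - 2)
    (hi : 1 ≤ i) (hij : i < j) (hj : j ≤ n) (r s : ℝ)
    (hr : r = ((-1 : ℝ) ^ (n - k) / (Nat.factorial (n - k) : ℝ)) /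
        (∑ l ∈ Finset.range (n - k + 1), (-1 : ℝ) ^ l / (Nat.factorial l : ℝ)))
    (hs : s = ((-1 : ℝ) ^ (n - k - 1) / (Nat.factorial (n - k - 1) : ℝ) +
          (-1 : ℝ) ^ (n - k) / (Nat.factorial (n - k) : ℝ)) /
        (∑ l ∈ Finset.range (n - k + 1), (-1 : ℝ) ^ l / (Nat.factorial l : ℝ))) :
    ((numPermsWithFixed n k : ℝ))⁻¹ *
        (((permsWithFixed n k).filter
            (fun σ => σ⁻¹ (⟨i - 1, by omega⟩ : Fin n) < σ⁻¹ (⟨j - 1, by omega⟩ : Fin n))).card : ℝ) =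
      (k : ℝ) * (((k : ℝ) - 1) / ((n : ℝ) * ((n : ℝ) - 1)) +
          ((n : ℝ) - (k : ℝ)) * ((j : ℝ) - 2) / ((n : ℝ) * ((n : ℝ) - 1) * ((n : ℝ) - 2))) +
      (1 - r) *
        ((k : ℝ) * ((n : ℝ) - (k : ℝ) - 1) * ((n : ℝ) - (i : ℝ) - 1) /
            ((n : ℝ) * ((n : ℝ) - 1) * ((n : ℝ) - 2)) +
          ((n : ℝ) - (k : ℝ) - 1) *
              ((i : ℝ) - 1 + (n : ℝ) - (j : ℝ) + ((n : ℝ) - 2) * ((n : ℝ) - 3 - (k : ℝ)) / 2) /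
            ((n : ℝ) * ((n : ℝ) - 1) * ((n : ℝ) - 2))) +
      (1 / ((k : ℝ) + 1)) * (1 - s) *
        (((k : ℝ) + 1) * (k : ℝ) * ((n : ℝ) - (i : ℝ) - 1) /
            ((n : ℝ) * ((n : ℝ) - 1) * ((n : ℝ) - 2)) +
          ((n : ℝ) - 2 - (k : ℝ)) * ((k : ℝ) + 1) / (2 * (n : ℝ) * ((n : ℝ) - 1))) := by
  have hkn : k + 2 ≤ n := by omega
  have hS := sum_alternating_ne_zero (m := n - k) (by omega)
  have hratio := numPermsWithFixed_add_two hkn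
  have hd : (numPermsWithFixed n k : ℝ) ≠ 0 := by
    rw [numPermsWithFixed_eq_div (by omega)]
    have := Nat.factorial_ne_zero n
    have := Nat.factorial_ne_zero k
    positivity
  obtain ⟨m, hm⟩ : ∃ m, n - k = m + 2 := ⟨n - k - 2, by omega⟩
  have hnm : (n : ℝ) = k + m + 2 := by exact_mod_cast (by omega : n = k + m + 2)
  have hsr : s = -(m + 1) * r := by
    rw [hs, hr, hm, show m + 2 - 1 = m + 1 by omega, Nat.factorial_succ (m + 1)]
    have := Nat.factorial_ne_zero (m + 1)
    push_cast
    field_simp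
    ring
  have hswap : ((k : ℝ) + 2) * (k + 1) * numPermsWithFixed n (k + 2) =
      numPermsWithFixed n k * (1 - s) := by
    refine mul_right_cancel₀ hS (hratio.trans ?_)
    rw [mul_assoc, sub_mul, hs, div_mul_cancel₀ _ hS, hm, show m + 2 - 1 = m + 1 by omega,
      Finset.sum_range_succ _ (m + 2), Finset.sum_range_succ _ (m + 1)]
    ring
  have key := two_mul_card_filter_lt_eq (k := k) (by omega : 2 < n)
    (i := ⟨i - 1, by omega⟩) (j := ⟨j - 1, by omega⟩) (Fin.mk_lt_mk.2 (by omega))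
  rw [← card_filter_inv_lt, hswap] at key
  simp only [Nat.cast_sub hi, Nat.cast_sub (hi.trans hij.le), Nat.cast_one] at key
  rw [inv_mul_eq_iff_eq_mul₀ hd, ← mul_right_inj' (two_ne_zero' ℝ), key, hsr, hnm]
  have : (k : ℝ) + m + 2 - 2 ≠ 0 := by
    have : (0 : ℝ) < k := by exact_mod_cast hk1
    have : (0 : ℝ) ≤ m := by positivity
    linarith
  have : (k : ℝ) + m + 2 - 1 ≠ 0 := by
    have : (0 : ℝ) ≤ m := by positivity
    have : (0 : ℝ) ≤ k := by positivity
    linarith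
  field_simp
  ring
end
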